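/- Let $R, R_d : \mathbb{R} \to \mathbb{R}^{3\times 3}$ be differentiable matrix-valued functions taking values in $SO(3)$, and let $\omega, \omega_d : \mathbb{R} \to \mathbb{R}^3$ satisfy $\dot{R}(t) = R(t)\hat{\omega}(t)$ and $\dot{R}_d(t) = R_d(t)\hat{\omega}_d(t)$ for all $t$. Define $e_R(t) = \tfrac{1}{2}\big(R_d(t)^\top R(t) - R(t)^\top R_d(t)\big)^\vee$ and $e_\omega(t) = \omega(t) - R(t)^\top R_d(t)\,\omega_d(t)$. Then for all $t$, $\dot{e}_R(t) = \tfrac{1}{2}\big(\operatorname{tr}(R(t)^\top R_d(t)) I_3 - R(t)^\top R_d(t)\big) e_\omega(t)$. -/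

import Mathlib

open Matrix

attribute [local instance] Matrix.normedAddCommGroup Matrix.normedSpace

/-- The hat map taking `a ∈ ℝ³` to the skew-symmetric matrix with `(hat a) b = a × b`. -/
def hat (a : Fin 3 → ℝ) : Matrix (Fin 3) (Fin 3) ℝ :=
  !![0, -a 2, a 1; a 2, 0, -a 0; -a 1, a 0, 0]

/-- The inverse of the hat map. -/
def vee (A : Matrix (Fin 3) (Fin 3) ℝ) : Fin 3 → ℝ := ![A 2 1, A 0 2, A 1 0]

/-- Membership in `SO(3)`: orthogonal with determinant one. -/
def SO3 (Q : Matrix (Fin 3) (Fin 3) ℝ) : Prop := Qᵀ * Q = 1 ∧ Q.det = 1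

theorem vee_transpose_mul_hat_add_hat_mul (A : Matrix (Fin 3) (Fin 3) ℝ) (x : Fin 3 → ℝ) :
    vee (Aᵀ * hat x + hat x * A) = (A.trace • (1 : Matrix (Fin 3) (Fin 3) ℝ) - A) *ᵥ x := by
  ext i
  fin_cases i <;>
    simp [vee, hat, Matrix.mul_apply, Matrix.mulVec, Matrix.vecMul, dotProduct, Fin.sum_univ_three,
      Matrix.trace, Matrix.one_apply] <;> ring

theorem transpose_hat (x : Fin 3 → ℝ) : (hat x)ᵀ = -hat x := by
  ext i j
  fin_cases i <;> fin_cases j <;> simp [hat]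

theorem adjugate_fin_three_eq_sq (A : Matrix (Fin 3) (Fin 3) ℝ) :
    A.adjugate = A * A - A.trace • A + A.adjugate.trace • (1 : Matrix (Fin 3) (Fin 3) ℝ) := by
  ext i j
  fin_cases i <;> fin_cases j <;>
    simp [Matrix.adjugate_fin_three, Matrix.mul_apply, Fin.sum_univ_three, Matrix.trace] <;> ring

theorem SO3.transpose_mul {P Q : Matrix (Fin 3) (Fin 3) ℝ} (hP : SO3 P) (hQ : SO3 Q) :
    SO3 (Pᵀ * Q) := by
  refine ⟨?_, by rw [Matrix.det_mul, Matrix.det_transpose, hP.2, hQ.2, one_mul]⟩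
  rw [Matrix.transpose_mul, Matrix.transpose_transpose, Matrix.mul_assoc, ← Matrix.mul_assoc P,
    mul_eq_one_comm.mp hP.1, Matrix.one_mul, hQ.1]

theorem SO3.adjugate_eq_transpose {Q : Matrix (Fin 3) (Fin 3) ℝ} (hQ : SO3 Q) :
    Q.adjugate = Qᵀ := by
  have h : Q * Q.adjugate = 1 := by rw [Matrix.mul_adjugate, hQ.2, one_smul]
  exact (left_inv_eq_right_inv hQ.1 h).symm

theorem SO3.trace_smul_one_sub_mul_self {Q : Matrix (Fin 3) (Fin 3) ℝ} (hQ : SO3 Q) :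
    (Q.trace • (1 : Matrix (Fin 3) (Fin 3) ℝ) - Q) * Q =
      Q.trace • (1 : Matrix (Fin 3) (Fin 3) ℝ) - Qᵀ := by
  have h := adjugate_fin_three_eq_sq Q
  rw [hQ.adjugate_eq_transpose, Matrix.trace_transpose] at h
  rw [h, Matrix.sub_mul, Matrix.smul_mul, Matrix.one_mul]
  abel

theorem vee_sub (A B : Matrix (Fin 3) (Fin 3) ℝ) : vee (A - B) = vee A - vee B := by
  ext i
  fin_cases i <;> simp [vee]

theorem hasDerivAt_matrix {m n : Type*} [Fintype m] [Fintype n] {F : ℝ → Matrix m n ℝ}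
    {F' : Matrix m n ℝ} {t : ℝ} :
    HasDerivAt F F' t ↔ ∀ i j, HasDerivAt (fun s => F s i j) (F' i j) t :=
  (hasDerivAt_pi (φ := F) (φ' := F')).trans (forall_congr' fun _ => hasDerivAt_pi)

theorem HasDerivAt.matrix_transpose {m n : Type*} [Fintype m] [Fintype n]
    {F : ℝ → Matrix m n ℝ} {F' : Matrix m n ℝ} {t : ℝ} (hF : HasDerivAt F F' t) :
    HasDerivAt (fun s => (F s)ᵀ) F'ᵀ t :=
  hasDerivAt_matrix.2 fun i j => hasDerivAt_matrix.1 hF j i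

theorem HasDerivAt.matrix_mul {l m n : Type*} [Fintype l] [Fintype m] [Fintype n]
    {F : ℝ → Matrix l m ℝ} {G : ℝ → Matrix m n ℝ} {F' : Matrix l m ℝ} {G' : Matrix m n ℝ} {t : ℝ}
    (hF : HasDerivAt F F' t) (hG : HasDerivAt G G' t) :
    HasDerivAt (fun s => F s * G s) (F' * G t + F t * G') t := by
  refine hasDerivAt_matrix.2 fun i j => ?_
  simp only [Matrix.mul_apply, Matrix.add_apply, ← Finset.sum_add_distrib]
  exact HasDerivAt.fun_sum fun k _ =>
    (hasDerivAt_matrix.1 hF i k).mul (hasDerivAt_matrix.1 hG k j)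

theorem HasDerivAt.vee {F : ℝ → Matrix (Fin 3) (Fin 3) ℝ} {F' : Matrix (Fin 3) (Fin 3) ℝ} {t : ℝ}
    (hF : HasDerivAt F F' t) : HasDerivAt (fun s => vee (F s)) (_root_.vee F') t := by
  rw [hasDerivAt_pi]
  intro i
  fin_cases i
  exacts [hasDerivAt_matrix.1 hF 2 1, hasDerivAt_matrix.1 hF 0 2, hasDerivAt_matrix.1 hF 1 0]

theorem stmt8 (R Rd : ℝ → Matrix (Fin 3) (Fin 3) ℝ) (ω ωd : ℝ → Fin 3 → ℝ)
    (hRso : ∀ t, SO3 (R t)) (hRdso : ∀ t, SO3 (Rd t))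
    (hR : ∀ t, HasDerivAt R (R t * hat (ω t)) t)
    (hRd : ∀ t, HasDerivAt Rd (Rd t * hat (ωd t)) t) :
    ∀ t,
      let eR : ℝ → Fin 3 → ℝ := fun s => (1/2 : ℝ) • vee ((Rd s)ᵀ * R s - (R s)ᵀ * Rd s)
      let eω : Fin 3 → ℝ := ω t - ((R t)ᵀ * Rd t).mulVec (ωd t)
      HasDerivAt eR
        (((1/2 : ℝ) • (Matrix.trace ((R t)ᵀ * Rd t) • (1 : Matrix (Fin 3) (Fin 3) ℝ)
          - (R t)ᵀ * Rd t)).mulVec eω) t := by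
  intro t eR eω
  have hD := (((hRd t).matrix_transpose.matrix_mul (hR t)).sub
    ((hR t).matrix_transpose.matrix_mul (hRd t))).vee.const_smul (1 / 2 : ℝ)
  refine HasDerivAt.congr_deriv (f := eR) hD ?_
  symm
  have hQ : SO3 ((R t)ᵀ * Rd t) := (hRso t).transpose_mul (hRdso t)
  have hQt : (Rd t)ᵀ * R t = ((R t)ᵀ * Rd t)ᵀ := by
    rw [Matrix.transpose_mul, Matrix.transpose_transpose]
  have hsplit : (Rd t * hat (ωd t))ᵀ * R t + (Rd t)ᵀ * (R t * hat (ω t)) -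
      ((R t * hat (ω t))ᵀ * Rd t + (R t)ᵀ * (Rd t * hat (ωd t))) =
      (((R t)ᵀ * Rd t)ᵀ * hat (ω t) + hat (ω t) * ((R t)ᵀ * Rd t)) -
      ((((R t)ᵀ * Rd t)ᵀ)ᵀ * hat (ωd t) + hat (ωd t) * ((R t)ᵀ * Rd t)ᵀ) := by
    rw [← hQt, Matrix.transpose_mul (Rd t), Matrix.transpose_mul (R t), transpose_hat,
      transpose_hat, Matrix.transpose_mul (Rd t)ᵀ, Matrix.transpose_transpose]
    simp only [Matrix.neg_mul, Matrix.mul_assoc]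
    abel
  rw [hsplit, vee_sub, vee_transpose_mul_hat_add_hat_mul, vee_transpose_mul_hat_add_hat_mul,
    Matrix.trace_transpose, ← hQ.trace_smul_one_sub_mul_self, Matrix.smul_mulVec,
    ← Matrix.mulVec_mulVec, ← Matrix.mulVec_sub]
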